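/- Let d ≥ 2 and let 𝔻 = (𝔇, w) be a special datum w.r.t. d such that {1,…,d} ∈ 𝔇. Then the number of cover pairs (J', J) with J', J ∈ 𝔇, J' ⊏ J and min J < min J' is exactly d − 1; consequently, the set 𝔑_𝔻 = { (1/w(J'))·(e_{min J} − e_{min J'}) : J', J ∈ 𝔇, J' ⊏ J, min J < min J' } ⊂ ℚ^d has exactly d − 1 elements. -/

import Mathlib

open Set BigOperators

namespace DHZ

/-- The cover relation `J' ⊏ J` within a family `D` of index-sets: `J' ⊊ J` and no member
of `D` lies strictly between `J'` and `J`. -/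
def Covers {d : ℕ} (D : Finset (Finset (Fin d))) (J' J : Finset (Fin d)) : Prop :=
  J' ⊂ J ∧ ∀ K ∈ D, ¬(J' ⊂ K ∧ K ⊂ J)

/-- A special datum `𝔻 = (𝔇, w)` w.r.t. `d` (Watanabe): a family `𝔇` of nonempty subsets
of `{1, …, d}` together with a weight function `w`, such that (i) all singletons belong to
`𝔇`; (ii) any two members are nested or disjoint; (iii) maximal members have weight `1`;
(iv) `J ⊊ J'` implies `w(J') < w(J)` and `w(J') ∣ w(J)`; (v) any two members covered by
the same `J` have equal weights. -/
structure SpecialDatum (d : ℕ) where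
  D : Finset (Finset (Fin d))
  w : Finset (Fin d) → ℕ
  nonempty_mem : ∀ J ∈ D, J.Nonempty
  singleton_mem : ∀ i : Fin d, {i} ∈ D
  nested : ∀ J ∈ D, ∀ J' ∈ D, J ⊆ J' ∨ J' ⊆ J ∨ J ∩ J' = ∅
  w_pos : ∀ J ∈ D, 0 < w J
  w_max : ∀ J ∈ D, (∀ J' ∈ D, J ⊆ J' → J' = J) → w J = 1
  w_strict : ∀ J ∈ D, ∀ J' ∈ D, J ⊂ J' → w J' < w J ∧ w J' ∣ w J
  w_cover : ∀ J₁ ∈ D, ∀ J₂ ∈ D, ∀ J ∈ D, Covers D J₁ J → Covers D J₂ J → w J₁ = w J₂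

/-- The minimum element of an index-set `J ⊆ {1, …, d}` (as a natural number). -/
noncomputable def minIdx {d : ℕ} (J : Finset (Fin d)) : ℕ :=
  sInf {n : ℕ | ∃ i ∈ J, (i : ℕ) = n}

/-- The `n`-th standard unit vector of `ℚ^d`. -/
def eQ (d : ℕ) (n : ℕ) : Fin d → ℚ := fun j => if (j : ℕ) = n then 1 else 0

/-- The set `𝔑_𝔻 = { (1/w(J'))·(e_{min J} − e_{min J'}) : J' ⊏ J, min J < min J' } ⊂ ℚ^d`. -/
def NDQ {d : ℕ} (𝔻 : SpecialDatum d) : Set (Fin d → ℚ) :=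
  { x | ∃ J ∈ 𝔻.D, ∃ J' ∈ 𝔻.D, Covers 𝔻.D J' J ∧ minIdx J < minIdx J' ∧
        x = ((𝔻.w J' : ℚ))⁻¹ • (eQ d (minIdx J) - eQ d (minIdx J')) }

/-- The lattice of weights `N_{G_𝔻}`: the subgroup of `ℚ^d` generated by `ℤ^d`
together with `𝔑_𝔻`. -/
def NGQ {d : ℕ} (𝔻 : SpecialDatum d) : Submodule ℤ (Fin d → ℚ) :=
  Submodule.span ℤ ((Set.range fun i : Fin d => eQ d (i : ℕ)) ∪ NDQ 𝔻)


theorem exists_mem_eq_minIdx {d : ℕ} {J : Finset (Fin d)} (hJ : J.Nonempty) :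
    ∃ i ∈ J, (i : ℕ) = minIdx J :=
  Nat.sInf_mem (s := {n : ℕ | ∃ i ∈ J, (i : ℕ) = n}) (hJ.elim fun i hi => ⟨i, i, hi, rfl⟩)

theorem minIdx_le {d : ℕ} {J : Finset (Fin d)} {i : Fin d} (hi : i ∈ J) : minIdx J ≤ i :=
  Nat.sInf_le ⟨i, hi, rfl⟩

theorem minIdx_anti {d : ℕ} {J K : Finset (Fin d)} (hJ : J.Nonempty) (h : J ⊆ K) :
    minIdx K ≤ minIdx J := by
  obtain ⟨i, hi, hiJ⟩ := exists_mem_eq_minIdx hJ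
  exact hiJ ▸ minIdx_le (h hi)

/-- The cover pairs `(J', J)` of `𝔻` with `min J < min J'`. -/
def minDropPairs {d : ℕ} (𝔻 : SpecialDatum d) : Set (Finset (Fin d) × Finset (Fin d)) :=
  {p | p.1 ∈ 𝔻.D ∧ p.2 ∈ 𝔻.D ∧ Covers 𝔻.D p.1 p.2 ∧ minIdx p.2 < minIdx p.1}

namespace SpecialDatum

variable {d : ℕ} (𝔻 : SpecialDatum d)

theorem subset_or_subset_of_mem {J K : Finset (Fin d)} (hJ : J ∈ 𝔻.D) (hK : K ∈ 𝔻.D)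
    {i : Fin d} (hiJ : i ∈ J) (hiK : i ∈ K) : J ⊆ K ∨ K ⊆ J := by
  rcases 𝔻.nested J hJ K hK with h | h | h
  · exact .inl h
  · exact .inr h
  · have hi : i ∈ J ∩ K := Finset.mem_inter.2 ⟨hiJ, hiK⟩
    simp [h] at hi

/-- A member whose cover has a smaller minimum contains every member with the same minimum. -/
theorem subset_of_minIdx_eq {J' J K' : Finset (Fin d)} (hp : (J', J) ∈ minDropPairs 𝔻)
    (hK' : K' ∈ 𝔻.D) (h : minIdx J' = minIdx K') : K' ⊆ J' := by
  obtain ⟨hJ', hJ, hcov, hlt⟩ := hp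
  dsimp only at hJ' hJ hcov hlt
  obtain ⟨i, hi, hiJ⟩ := exists_mem_eq_minIdx (𝔻.nonempty_mem J' hJ')
  obtain ⟨k, hk, hkK⟩ := exists_mem_eq_minIdx (𝔻.nonempty_mem K' hK')
  obtain rfl : i = k := Fin.ext (by omega)
  rcases 𝔻.subset_or_subset_of_mem hJ' hK' hi hk with hs | hs
  · by_contra hns
    rcases 𝔻.subset_or_subset_of_mem hJ hK' (hcov.1.1 hi) hk with hs' | hs'
    · have := minIdx_anti (𝔻.nonempty_mem J hJ) hs'
      omega
    · refine hcov.2 K' hK' ⟨⟨hs, hns⟩, hs', fun hs'' => ?_⟩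
      have := minIdx_anti (𝔻.nonempty_mem J hJ) hs''
      omega
  · exact hs

theorem eq_of_covers {J K K' : Finset (Fin d)} (hJ : J ∈ 𝔻.D) (hK : K ∈ 𝔻.D)
    (hK' : K' ∈ 𝔻.D) (h : Covers 𝔻.D J K) (h' : Covers 𝔻.D J K') : K = K' := by
  obtain ⟨i, hi⟩ := 𝔻.nonempty_mem J hJ
  rcases 𝔻.subset_or_subset_of_mem hK hK' (h.1.1 hi) (h'.1.1 hi) with hs | hs
  · by_contra hne
    exact h'.2 K hK ⟨h.1, hs.ssubset_of_ne hne⟩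
  · by_contra hne
    exact h.2 K' hK' ⟨h'.1, hs.ssubset_of_ne (Ne.symm hne)⟩

theorem injOn_minIdx_fst : Set.InjOn (fun p => minIdx p.1) (minDropPairs 𝔻) := by
  rintro ⟨J', J⟩ hp ⟨K', K⟩ hq h
  dsimp only at h
  obtain rfl : J' = K' := (𝔻.subset_of_minIdx_eq hq hp.1 h.symm).antisymm
    (𝔻.subset_of_minIdx_eq hp hq.1 h)
  exact congrArg (J', ·) (𝔻.eq_of_covers hp.1 hp.2.1 hq.2.1 hp.2.2.1 hq.2.2.1)

theorem minIdx_singleton (i : Fin d) : minIdx {i} = i := by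
  obtain ⟨j, hj, h⟩ := exists_mem_eq_minIdx (Finset.singleton_nonempty i)
  rw [← h, Finset.mem_singleton.1 hj]

theorem image_minIdx_fst (hfull : Finset.univ ∈ 𝔻.D) :
    (fun p => minIdx p.1) '' minDropPairs 𝔻 = Set.Ico 1 d := by
  ext m
  constructor
  · rintro ⟨⟨J', J⟩, hp, rfl⟩
    obtain ⟨i, -, hi⟩ := exists_mem_eq_minIdx (𝔻.nonempty_mem J' hp.1)
    have := hp.2.2.2
    exact ⟨by dsimp only at *; omega, by dsimp only at *; omega⟩
  · rintro ⟨hm, hmd⟩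
    obtain ⟨J', hJ'⟩ := (𝔻.D.filter (minIdx · = m)).exists_maximal
      ⟨{⟨m, hmd⟩}, by simp [𝔻.singleton_mem, minIdx_singleton]⟩
    have hJ'D := (Finset.mem_filter.1 hJ'.prop).1
    have hJ'm := (Finset.mem_filter.1 hJ'.prop).2
    have huniv : J' ⊂ Finset.univ := by
      refine (Finset.subset_univ J').ssubset_of_ne ?_
      rintro rfl
      have := minIdx_le (Finset.mem_univ (⟨0, by omega⟩ : Fin d))
      dsimp only at this
      omega
    obtain ⟨J, hJ⟩ := (𝔻.D.filter (J' ⊂ ·)).exists_minimal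
      ⟨Finset.univ, by simpa [hfull] using huniv⟩
    obtain ⟨hJD, hJJ⟩ := Finset.mem_filter.1 hJ.prop
    refine ⟨(J', J), ⟨hJ'D, hJD, ⟨hJJ, fun K hK hlt => ?_⟩, ?_⟩, hJ'm⟩
    · exact hlt.2.2 (hJ.le_of_le (Finset.mem_filter.2 ⟨hK, hlt.1⟩) hlt.2.1)
    · refine (minIdx_anti (𝔻.nonempty_mem J' hJ'D) hJJ.1).lt_of_ne fun h => ?_
      exact hJJ.2 (hJ'.le_of_ge (Finset.mem_filter.2 ⟨hJD, h.trans hJ'm⟩) hJJ.1)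

theorem ncard_minDropPairs (hfull : Finset.univ ∈ 𝔻.D) :
    (minDropPairs 𝔻).ncard = d - 1 := by
  rw [← 𝔻.injOn_minIdx_fst.ncard_image, 𝔻.image_minIdx_fst hfull, ← Finset.coe_Ico,
    Set.ncard_coe_finset, Nat.card_Ico]

/-- The element of `NDQ 𝔻` attached to a cover pair. -/
noncomputable def pairVector (p : Finset (Fin d) × Finset (Fin d)) : Fin d → ℚ :=
  ((𝔻.w p.1 : ℚ))⁻¹ • (eQ d (minIdx p.2) - eQ d (minIdx p.1))

theorem NDQ_eq_image : NDQ 𝔻 = 𝔻.pairVector '' minDropPairs 𝔻 := by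
  ext x
  constructor
  · rintro ⟨J, hJ, J', hJ', hcov, hlt, rfl⟩
    exact ⟨(J', J), ⟨hJ', hJ, hcov, hlt⟩, rfl⟩
  · rintro ⟨⟨J', J⟩, ⟨hJ', hJ, hcov, hlt⟩, rfl⟩
    exact ⟨J, hJ, J', hJ', hcov, hlt, rfl⟩

theorem pairVector_neg_iff {p : Finset (Fin d) × Finset (Fin d)} (hp : p ∈ minDropPairs 𝔻)
    (j : Fin d) : 𝔻.pairVector p j < 0 ↔ (j : ℕ) = minIdx p.1 := by
  have hw : (0 : ℚ) < (𝔻.w p.1 : ℚ)⁻¹ := by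
    have := 𝔻.w_pos p.1 hp.1
    positivity
  have hlt := hp.2.2.2
  simp only [pairVector, Pi.smul_apply, Pi.sub_apply, smul_neg_iff_of_pos_left hw, eQ]
  split_ifs with h₁ h₂ h₂
  · omega
  · simp [h₂]
  · simp [h₂]
  · simp [h₂]

theorem injOn_pairVector : Set.InjOn 𝔻.pairVector (minDropPairs 𝔻) := by
  intro p hp q hq h
  refine 𝔻.injOn_minIdx_fst hp hq ?_
  obtain ⟨i, -, hi⟩ := exists_mem_eq_minIdx (𝔻.nonempty_mem p.1 hp.1)
  exact hi.symm.trans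
    ((𝔻.pairVector_neg_iff hq i).1 (h ▸ (𝔻.pairVector_neg_iff hp i).2 hi))

end SpecialDatum

/-- For a special datum `𝔻 = (𝔇, w)` w.r.t. `d ≥ 2` with `{1,…,d} ∈ 𝔇`, the number of
cover pairs `(J', J)` with `J' ⊏ J` and `min J < min J'` is exactly `d - 1`; consequently
the set `𝔑_𝔻` has exactly `d - 1` elements. -/
theorem card_ND_eq {d : ℕ} (hd : 2 ≤ d) (𝔻 : SpecialDatum d)
    (hfull : (Finset.univ : Finset (Fin d)) ∈ 𝔻.D) :
    {p : Finset (Fin d) × Finset (Fin d) |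
        p.1 ∈ 𝔻.D ∧ p.2 ∈ 𝔻.D ∧ Covers 𝔻.D p.1 p.2 ∧ minIdx p.2 < minIdx p.1}.ncard
      = d - 1 ∧
    (NDQ 𝔻).ncard = d - 1 := by
  have h := 𝔻.ncard_minDropPairs hfull
  exact ⟨h, by rw [𝔻.NDQ_eq_image, 𝔻.injOn_pairVector.ncard_image, h]⟩

end DHZ
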